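/- arXiv:1006.2720 — 6 statements merged into one kernel-verified Lean document; each statement's English description precedes it below -/
import Mathlib

section
/- For every commutative ring A and every p-typical Witt vector x ∈ W(A), the Frobenius satisfies f(x) ≡ x^p modulo p·W(A); that is, there exists y ∈ W(A) with f(x) = x^p + p·y. Moreover, if all coefficients of x are nilpotent and all but finitely many are zero, then y can be chosen so that all of its coefficients are nilpotent and all but finitely many are zero. -/
/-- A Witt vector has "hat" support: all coefficients nilpotent and all but
finitely many zero. -/
def WittVector.IsHat {p : ℕ} {A : Type*} [CommRing A] (x : WittVector p A) : Prop :=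
  (∀ n, IsNilpotent (x.coeff n)) ∧ ∃ N, ∀ n ≥ N, x.coeff n = 0

namespace WittVector

open Polynomial

variable {p : ℕ} [hp : Fact p.Prime] {R A : Type*} [CommRing R] [CommRing A]

theorem ext_ghostComponent_mvPolynomial {σ : Type*} {x y : WittVector p (MvPolynomial σ ℤ)}
    (h : ∀ n, ghostComponent n x = ghostComponent n y) : x = y := by
  apply map_injective (MvPolynomial.map (Int.castRingHom ℚ))
    (MvPolynomial.map_injective _ Int.cast_injective)
  have : Invertible (p : MvPolynomial σ ℚ) :=
    Invertible.copy (Invertible.map (MvPolynomial.C : ℚ →+* MvPolynomial σ ℚ) (p : ℚ)) _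
      (map_natCast _ p).symm
  apply (ghostMap.bijective_of_invertible p _).injective
  funext n
  have key (z : WittVector p (MvPolynomial σ ℤ)) :
      ghostComponent n (map (MvPolynomial.map (Int.castRingHom ℚ)) z) =
        MvPolynomial.map (Int.castRingHom ℚ) (ghostComponent n z) := by
    simp [ghostComponent_apply, aeval_wittPolynomial]
  rw [ghostMap_apply, ghostMap_apply, key, key, h]

theorem frobenius_teichmuller (r : R) : frobenius (teichmuller p r) = teichmuller p r ^ p := by
  have h : frobenius (teichmuller p (MvPolynomial.X r : MvPolynomial R ℤ)) =
      teichmuller p (MvPolynomial.X r) ^ p :=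
    ext_ghostComponent_mvPolynomial fun n ↦ by
      rw [ghostComponent_frobenius, map_pow, ghostComponent_teichmuller,
        ghostComponent_teichmuller, pow_succ, pow_mul]
  have h' := congrArg (map (MvPolynomial.aeval id : MvPolynomial R ℤ →ₐ[ℤ] R).toRingHom) h
  rw [(frobenius_isPoly p).map, map_pow, map_teichmuller] at h'
  simpa using h'

theorem coeff_teichmuller_mul (r : R) (x : WittVector p R) (n : ℕ) :
    (teichmuller p r * x).coeff n = r ^ p ^ n * x.coeff n := by
  have h : teichmuller p (MvPolynomial.X r : MvPolynomial R ℤ) *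
      mk p (fun n ↦ MvPolynomial.X (x.coeff n)) =
        mk p (fun n ↦ MvPolynomial.X r ^ p ^ n * MvPolynomial.X (x.coeff n)) := by
    refine ext_ghostComponent_mvPolynomial fun n ↦ ?_
    rw [map_mul, ghostComponent_teichmuller, ghostComponent_apply, ghostComponent_apply,
      aeval_wittPolynomial, aeval_wittPolynomial, Finset.mul_sum]
    refine Finset.sum_congr rfl fun i hi ↦ ?_
    have hin : i + (n - i) = n := by grind
    rw [coeff_mk, coeff_mk, mul_pow, ← pow_mul, ← pow_add, hin]
    ring
  have h' := congrArg (map (MvPolynomial.aeval id : MvPolynomial R ℤ →ₐ[ℤ] R).toRingHom) h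
  rw [map_mul, map_teichmuller] at h'
  have hx : map (MvPolynomial.aeval id : MvPolynomial R ℤ →ₐ[ℤ] R).toRingHom
      (mk p (fun n ↦ MvPolynomial.X (x.coeff n))) = x := by
    ext n
    simp [map_coeff]
  rw [hx] at h'
  simpa [map_coeff] using congrArg (fun z ↦ z.coeff n) h'

theorem teichmuller_add_verschiebung_shift (x : WittVector p R) :
    teichmuller p (x.coeff 0) + verschiebung (x.shift 1) = x := by
  ext n
  rw [coeff_add_of_disjoint]
  · cases n with
    | zero => simp
    | succ n => simp [teichmuller_coeff_pos, shift_coeff, add_comm]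
  · intro n
    cases n with
    | zero => simp
    | succ n => simp [teichmuller_coeff_pos]

theorem mem_range_map_subtype {S : Subring R} {x : WittVector p R} :
    x ∈ (map (p := p) S.subtype).range ↔ ∀ n, x.coeff n ∈ S := by
  constructor
  · rintro ⟨y, rfl⟩ n
    rw [map_coeff]
    exact (y.coeff n).2
  · intro h
    exact ⟨mk p fun n ↦ ⟨x.coeff n, h n⟩, by ext n; simp [map_coeff]⟩

/-- Polynomials in finitely many nilpotent elements of `A[X]` have bounded degree. -/
theorem exists_adjoin_le_degreeLT {s : Set A[X]} (hs : s.Finite)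
    (hnil : ∀ f ∈ s, IsNilpotent f) :
    ∃ N, Subalgebra.toSubmodule (Algebra.adjoin A s) ≤ degreeLT A N := by
  have hint : ∀ f ∈ s, IsIntegral A f := fun f hf ↦ by
    obtain ⟨n, hn⟩ := hnil f hf
    refine .of_pow n.succ_pos ?_
    rw [pow_succ, hn, zero_mul]
    exact isIntegral_zero
  obtain ⟨t, ht⟩ := fg_adjoin_of_finite hs hint
  obtain ⟨N, hN⟩ := Polynomial.span_of_finite_le_degreeLT (R := A) t.finite_toSet
  exact ⟨N, ht ▸ hN⟩

theorem eventually_coeff_eq_zero_of_teichmuller_mul_mem {s : Set A[X]} (hs : s.Finite)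
    (hnil : ∀ f ∈ s, IsNilpotent f) {x : WittVector p A}
    (hx : teichmuller p X * map C x ∈
      (map (p := p) (Algebra.adjoin A s).toSubring.subtype).range) :
    ∃ N, ∀ n ≥ N, x.coeff n = 0 := by
  obtain ⟨N, hN⟩ := exists_adjoin_le_degreeLT hs hnil
  refine ⟨N, fun n hn ↦ ?_⟩
  have hmem := hN (mem_range_map_subtype.1 hx n)
  rw [coeff_teichmuller_mul, map_coeff, mem_degreeLT] at hmem
  have hlt : N ≤ p ^ n := hn.trans (Nat.lt_pow_self hp.out.one_lt).le
  have := coeff_eq_zero_of_degree_lt (hmem.trans_le (Nat.cast_le.2 hlt))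
  simpa [X_pow_mul] using this

/-- The coefficients of `[X] * x` in `A[X]`. -/
def scaledCoeffs (x : WittVector p A) : Set A[X] :=
  Set.range fun n ↦ (X ^ p ^ n * C (x.coeff n) : A[X])

theorem teichmuller_mul_mem {x : WittVector p A} {s : Set A[X]} (h : scaledCoeffs x ⊆ s) :
    teichmuller p X * map C x ∈
      (map (p := p) (Algebra.adjoin A s).toSubring.subtype).range := by
  refine mem_range_map_subtype.2 fun n ↦ Algebra.subset_adjoin (h ⟨n, ?_⟩)
  rw [coeff_teichmuller_mul, map_coeff]

omit hp in
theorem IsHat.finite_scaledCoeffs {x : WittVector p A} (hx : x.IsHat) :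
    (scaledCoeffs x).Finite := by
  obtain ⟨N, hN⟩ := hx.2
  refine (((Set.finite_Iio N).image fun n ↦ (X ^ p ^ n * C (x.coeff n) : A[X])).union
    (Set.finite_singleton 0)).subset ?_
  rintro _ ⟨n, rfl⟩
  rcases lt_or_ge n N with h | h
  · exact Or.inl ⟨n, h, rfl⟩
  · exact Or.inr (by simp [hN n h])

omit hp in
theorem IsHat.isNilpotent_of_mem_scaledCoeffs {x : WittVector p A} (hx : x.IsHat) :
    ∀ f ∈ scaledCoeffs x, IsNilpotent f := by
  rintro _ ⟨n, rfl⟩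
  exact (Commute.all _ _).isNilpotent_mul_left ((hx.1 n).map C)

theorem forall_isNilpotent_coeff_iff {x : WittVector p A} :
    (∀ n, IsNilpotent (x.coeff n)) ↔ map (Ideal.Quotient.mk (nilradical A)) x = 0 := by
  simp [WittVector.ext_iff, map_coeff, Ideal.Quotient.eq_zero_iff_mem, mem_nilradical]

theorem IsHat.add {x y : WittVector p A} (hx : x.IsHat) (hy : y.IsHat) : (x + y).IsHat := by
  constructor
  · have hx' := forall_isNilpotent_coeff_iff.1 hx.1
    have hy' := forall_isNilpotent_coeff_iff.1 hy.1
    rw [forall_isNilpotent_coeff_iff, map_add, hx', hy', add_zero]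
  · refine eventually_coeff_eq_zero_of_teichmuller_mul_mem
      (hx.finite_scaledCoeffs.union hy.finite_scaledCoeffs) ?_ ?_
    · rintro f (hf | hf)
      exacts [hx.isNilpotent_of_mem_scaledCoeffs f hf, hy.isNilpotent_of_mem_scaledCoeffs f hf]
    · rw [map_add, mul_add]
      exact add_mem (teichmuller_mul_mem Set.subset_union_left)
        (teichmuller_mul_mem Set.subset_union_right)

theorem IsHat.mul_left {x : WittVector p A} (hx : x.IsHat) (y : WittVector p A) :
    (y * x).IsHat := by
  constructor
  · rw [forall_isNilpotent_coeff_iff, map_mul, forall_isNilpotent_coeff_iff.1 hx.1, mul_zero]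
  · refine eventually_coeff_eq_zero_of_teichmuller_mul_mem hx.finite_scaledCoeffs
      hx.isNilpotent_of_mem_scaledCoeffs ?_
    rw [map_mul, mul_left_comm]
    refine mul_mem (mem_range_map_subtype.2 fun n ↦ ?_) (teichmuller_mul_mem subset_rfl)
    rw [map_coeff]
    exact (Algebra.adjoin A _).algebraMap_mem (y.coeff n)

variable (p A) in
/-- The ideal of Witt vectors with nilpotent coefficients, almost all of them zero. -/
def hatIdeal : Ideal (WittVector p A) where
  carrier := {x | x.IsHat}
  add_mem' := IsHat.add
  zero_mem' := ⟨fun n ↦ by simp, 0, fun n _ ↦ by simp⟩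
  smul_mem' y _ hx := hx.mul_left y

theorem mem_hatIdeal {x : WittVector p A} : x ∈ hatIdeal p A ↔ x.IsHat := Iff.rfl

theorem IsHat.verschiebung {x : WittVector p A} (hx : x.IsHat) :
    (WittVector.verschiebung x).IsHat := by
  obtain ⟨N, hN⟩ := hx.2
  refine ⟨fun n ↦ ?_, N + 1, fun n hn ↦ ?_⟩
  · cases n with
    | zero => simp
    | succ n => simpa using hx.1 n
  · cases n with
    | zero => simp
    | succ n => simpa using hN n (by omega)

omit hp in
theorem IsHat.shift {x : WittVector p A} (hx : x.IsHat) (k : ℕ) : (x.shift k).IsHat := by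
  obtain ⟨N, hN⟩ := hx.2
  refine ⟨fun n ↦ ?_, N, fun n hn ↦ ?_⟩ <;> rw [shift_coeff]
  exacts [hx.1 _, hN _ (by omega)]

theorem verschiebung_mul_verschiebung (x y : WittVector p A) :
    verschiebung x * verschiebung y = p * verschiebung (x * y) := by
  rw [← verschiebung_mul_frobenius, frobenius_verschiebung, ← mul_assoc,
    mul_comm _ (p : WittVector p A), ← nsmul_eq_mul, map_nsmul, nsmul_eq_mul]

/-- `f(x) - x ^ p` is `p` times an element of the ideal generated by
`x.shift 1`, `v (x.shift 1)` and `v (x.shift 1 * x.shift 1)`. -/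
theorem exists_frobenius_eq_pow_add (x : WittVector p A) : ∃ a b : WittVector p A,
    frobenius x = x ^ p + p * (x.shift 1 - a * verschiebung (x.shift 1) -
      b * verschiebung (x.shift 1 * x.shift 1)) := by
  set z := x.shift 1
  have hx := teichmuller_add_verschiebung_shift x
  obtain ⟨r, hr⟩ := exists_add_pow_prime_eq hp.out (teichmuller p (x.coeff 0)) (verschiebung z)
  rw [hx] at hr
  have hf : frobenius x = teichmuller p (x.coeff 0) ^ p + z * p := by
    conv_lhs => rw [← hx]
    rw [map_add, frobenius_teichmuller, frobenius_verschiebung]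
  have hv : verschiebung z ^ p =
      p * (verschiebung z ^ (p - 2) * verschiebung (z * z)) := by
    rw [mul_left_comm, ← verschiebung_mul_verschiebung, ← pow_two, ← pow_add,
      Nat.sub_add_cancel hp.out.two_le]
  refine ⟨r * teichmuller p (x.coeff 0), verschiebung z ^ (p - 2), ?_⟩
  rw [hf, hr, hv]
  ring

end WittVector

/-- For every commutative ring `A` and every `x ∈ W(A)`,
`f(x) ≡ x^p mod p·W(A)`; moreover if `x` has nilpotent coefficients, almost all
zero, then the witness `y` may be chosen with the same property. -/
theorem frobenius_congr_pow_p (p : ℕ) [Fact p.Prime] (A : Type*) [CommRing A]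
    (x : WittVector p A) :
    (∃ y : WittVector p A, WittVector.frobenius x = x ^ p + p * y) ∧
    (x.IsHat →
      ∃ y : WittVector p A,
        WittVector.frobenius x = x ^ p + p * y ∧ y.IsHat) := by
  obtain ⟨a, b, h⟩ := x.exists_frobenius_eq_pow_add
  refine ⟨⟨_, h⟩, fun hx ↦ ⟨_, h, ?_⟩⟩
  have hz := hx.shift 1
  exact WittVector.mem_hatIdeal.1 <| sub_mem
    (sub_mem (WittVector.mem_hatIdeal.2 hz) (hz.verschiebung.mul_left a))
    ((hz.mul_left _).verschiebung.mul_left b)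
end

section
/- Let A be a perfect ring of characteristic p, let n ≥ 1, and let B be a commutative ring with p^n·1_B = 0 together with an ideal J ⊆ B that is bounded nilpotent (there exists m such that x^m = 0 for every x ∈ J). Then every ring homomorphism g : A → B/J lifts to a unique ring homomorphism h : W_n(A) → B, i.e. there is exactly one ring homomorphism h : W_n(A) → B such that the composite of h with the projection B → B/J equals the composite of the zeroth-coefficient projection W_n(A) → A with g. -/
/-- Elements congruent modulo a bounded nilpotent ideal have equal high `p`-power powers
in a ring where `p` is nilpotent. -/
theorem pow_prime_pow_eq_of_sub_mem {p : ℕ} [hp : Fact p.Prime] {B : Type*} [CommRing B]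
    {J : Ideal B} {m n : ℕ} (hB : (p : B) ^ n = 0) (hJ : ∀ x ∈ J, x ^ m = 0)
    {a b : B} (hab : a - b ∈ J) : a ^ p ^ (m + n) = b ^ p ^ (m + n) := by
  have hdvd : (p : B) ∣ a ^ p ^ m - b ^ p ^ m := by
    obtain ⟨r, hr⟩ := exists_add_pow_prime_pow_eq hp.out (a - b) b m
    rw [sub_add_cancel,
      pow_eq_zero_of_le (Nat.lt_pow_self hp.out.one_lt).le (hJ _ hab), zero_add] at hr
    rw [hr, add_sub_cancel_left, mul_assoc, mul_assoc]
    exact dvd_mul_right _ _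
  have h := dvd_sub_pow_of_dvd_sub hdvd n
  rwa [pow_succ, hB, zero_mul, zero_dvd_iff, sub_eq_zero, ← pow_mul, ← pow_mul, ← pow_add] at h

namespace WittVector

variable {p : ℕ} [hp : Fact p.Prime]

theorem ker_map_le_ker_ghostComponent {B : Type*} [CommRing B]
    {J : Ideal B} {m n : ℕ} (hB : (p : B) ^ n = 0) (hJ : ∀ x ∈ J, x ^ m = 0) :
    RingHom.ker (map (p := p) (Ideal.Quotient.mk J)) ≤
      RingHom.ker (ghostComponent (p := p) (R := B) (m + n)) := by
  intro x hx
  rw [RingHom.mem_ker, map_eq_zero_iff] at hx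
  rw [RingHom.mem_ker, ghostComponent_apply, aeval_wittPolynomial]
  refine Finset.sum_eq_zero fun i _ => ?_
  rcases le_total n i with hi | hi
  · rw [pow_eq_zero_of_le hi hB, zero_mul]
  · have hle : m ≤ p ^ (m + n - i) :=
      (by lia : m ≤ m + n - i).trans (Nat.lt_pow_self hp.out.one_lt).le
    rw [pow_eq_zero_of_le hle (hJ _ (Ideal.Quotient.eq_zero_iff_mem.mp (hx i))), mul_zero]

theorem mk_ghostComponent_of_natCast_eq_zero {B : Type*} [CommRing B] {J : Ideal B}
    (hpJ : (p : B ⧸ J) = 0) (k : ℕ) (x : WittVector p B) :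
    Ideal.Quotient.mk J (ghostComponent k x) = Ideal.Quotient.mk J (x.coeff 0) ^ p ^ k := by
  rw [ghostComponent_apply, aeval_wittPolynomial, map_sum,
    Finset.sum_eq_single_of_mem 0 (by simp)]
  · simp
  · intro i _ hi
    simp [hpJ, hi]

variable {A : Type*} [CommRing A] [CharP A p] [PerfectRing A p]

theorem exists_lift_of_bounded_nilpotent {B : Type*} [CommRing B] {J : Ideal B} {m n : ℕ}
    (hB : (p : B) ^ n = 0) (hJ : ∀ x ∈ J, x ^ m = 0) (g : A →+* B ⧸ J) :
    ∃ f : WittVector p A →+* B, ∀ x, Ideal.Quotient.mk J (f x) = g (x.coeff 0) := by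
  have hpJ : (p : B ⧸ J) = 0 := by
    rw [← map_natCast g, CharP.cast_eq_zero, map_zero]
  have hsurj := map_surjective (p := p) (Ideal.Quotient.mk J) Ideal.Quotient.mk_surjective
  let ghostLift : WittVector p (B ⧸ J) →+* B :=
    RingHom.liftOfSurjective _ hsurj ⟨_, ker_map_le_ker_ghostComponent hB hJ⟩
  have hlift (y : WittVector p B) :
      ghostLift (map (Ideal.Quotient.mk J) y) = ghostComponent (m + n) y :=
    RingHom.liftOfSurjective_comp_apply ..
  let σ : A →+* A := (iterateFrobeniusEquiv A p (m + n)).symm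
  have hσ (a : A) : σ a ^ p ^ (m + n) = a :=
    (iterateFrobeniusEquiv A p (m + n)).apply_symm_apply a
  refine ⟨ghostLift.comp (map (g.comp σ)), fun x => ?_⟩
  obtain ⟨y, hy⟩ := hsurj (map (g.comp σ) x)
  rw [RingHom.comp_apply, ← hy, hlift, mk_ghostComponent_of_natCast_eq_zero hpJ,
    ← map_coeff, hy, map_coeff, RingHom.comp_apply, ← map_pow, hσ]

theorem ker_truncate_le_ker {B : Type*} [CommRing B] {n : ℕ} (hB : (p : B) ^ n = 0)
    (f : WittVector p A →+* B) :
    RingHom.ker (truncate (p := p) (R := A) n) ≤ RingHom.ker f := by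
  intro x hx
  rw [mem_ker_truncate, ← mem_span_p_pow_iff_le_coeff_eq_zero, Ideal.mem_span_singleton] at hx
  obtain ⟨y, rfl⟩ := hx
  rw [RingHom.mem_ker, map_mul, map_pow, map_natCast, hB, zero_mul]

theorem ringHom_eq_of_sub_mem {B : Type*} [CommRing B] {J : Ideal B} {m n : ℕ}
    (hB : (p : B) ^ n = 0) (hJ : ∀ x ∈ J, x ^ m = 0) {f₁ f₂ : WittVector p A →+* B}
    (h : ∀ x, f₁ x - f₂ x ∈ J) : f₁ = f₂ := by
  refine eq_of_apply_teichmuller_eq f₁ f₂ ⟨n, hB⟩ fun x => ?_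
  obtain ⟨y, rfl⟩ := (iterateFrobeniusEquiv A p (m + n)).surjective x
  rw [iterateFrobeniusEquiv_def, map_pow, map_pow, map_pow]
  exact pow_prime_pow_eq_of_sub_mem hB hJ (h _)

end WittVector

/-- Let `A` be a perfect ring of characteristic `p`, `n ≥ 1`,
and `B` a commutative ring with `p^n·1_B = 0`, with a bounded nilpotent ideal
`J ⊆ B`. Every ring homomorphism `g : A → B/J` lifts to a unique ring
homomorphism `h : W_n(A) → B` over the zeroth-coefficient projection. -/
theorem lift_from_truncated_witt_unique (p : ℕ) [Fact p.Prime]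
    (A : Type*) [CommRing A] [CharP A p]
    (hA : Function.Bijective fun x : A => x ^ p)
    (n : ℕ) (hn : 1 ≤ n)
    (B : Type*) [CommRing B] (hB : (p : B) ^ n = 0)
    (J : Ideal B) (hJ : ∃ m : ℕ, 1 ≤ m ∧ ∀ x ∈ J, x ^ m = 0)
    (g : A →+* B ⧸ J) :
    ∃! h : TruncatedWittVector p n A →+* B,
      ∀ a : TruncatedWittVector p n A,
        Ideal.Quotient.mk J (h a) = g (a.coeff ⟨0, hn⟩) := by
  have : PerfectRing A p := ⟨hA⟩
  obtain ⟨m, -, hm⟩ := hJ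
  have hsurj := WittVector.truncate_surjective p n A
  obtain ⟨f, hf⟩ := WittVector.exists_lift_of_bounded_nilpotent hB hm g
  refine ⟨RingHom.liftOfSurjective _ hsurj ⟨f, WittVector.ker_truncate_le_ker hB f⟩,
    fun a => ?_, fun h hh => ?_⟩
  · obtain ⟨x, rfl⟩ := hsurj a
    rw [RingHom.liftOfSurjective_comp_apply, hf, WittVector.coeff_truncate]
  · refine RingHom.eq_liftOfRightInverse _ _ _ _ _ _ ?_
    refine WittVector.ringHom_eq_of_sub_mem hB hm fun x => ?_
    rw [← Ideal.Quotient.eq, RingHom.comp_apply, hh, hf, WittVector.coeff_truncate]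
end

section
/- In the ring W(ℤ_p) of p-typical Witt vectors of the p-adic integers, the element p − [p] lies in the image of the Verschiebung v; the element u_0 ∈ W(ℤ_p) with v(u_0) = p − [p] is unique; all coefficients of u_0 − 1 lie in the ideal pℤ_p; and u_0 is a unit of W(ℤ_p). -/
namespace WittVector

variable {p : ℕ} {R : Type*} [CommRing R]

theorem pow_dvd_sum_range_sub_sum_range (hR : ∀ a : R, (p : R) ∣ a ^ p - a) (y : ℕ → R) (n : ℕ) :
    (p : R) ^ (n + 1) ∣ ∑ i ∈ Finset.range (n + 1), (p : R) ^ i * y i ^ p ^ (n + 1 - i) -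
      ∑ i ∈ Finset.range (n + 1), (p : R) ^ i * y i ^ p ^ (n - i) := by
  rw [← Finset.sum_sub_distrib]
  refine Finset.dvd_sum fun i hi => ?_
  have hi : i ≤ n := Finset.mem_range_succ_iff.mp hi
  have h := mul_dvd_mul_left ((p : R) ^ i) (dvd_sub_pow_of_dvd_sub (hR (y i)) (n - i))
  rwa [← pow_add, ← pow_mul, ← pow_succ', mul_sub, show i + (n - i + 1) = n + 1 by lia,
    show n - i + 1 = n + 1 - i by lia] at h

variable [hp : Fact p.Prime]

theorem ghostComponent_eq_sum (x : WittVector p R) (n : ℕ) :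
    ghostComponent n x = ∑ i ∈ Finset.range (n + 1), (p : R) ^ i * x.coeff i ^ p ^ (n - i) := by
  rw [ghostComponent_apply, aeval_wittPolynomial]

theorem ghostMap_injective_of_ne_zero [IsDomain R] (h : (p : R) ≠ 0) :
    Function.Injective (ghostMap : WittVector p R → ℕ → R) := by
  intro x y hxy
  ext n
  induction n using Nat.strong_induction_on with
  | _ n ih =>
    have hn := congrFun hxy n
    simp only [ghostMap_apply, ghostComponent_eq_sum, Finset.sum_range_succ] at hn
    rw [Finset.sum_congr rfl fun i hi => by rw [ih i (Finset.mem_range.mp hi)]] at hn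
    simpa [h] using hn

theorem pow_dvd_ghostComponent_succ_sub (hR : ∀ a : R, (p : R) ∣ a ^ p - a) (x : WittVector p R)
    (n : ℕ) : (p : R) ^ (n + 1) ∣ ghostComponent (n + 1) x - ghostComponent n x := by
  rw [ghostComponent_eq_sum, ghostComponent_eq_sum, Finset.sum_range_succ, add_sub_right_comm]
  exact dvd_add (pow_dvd_sum_range_sub_sum_range hR _ n) (dvd_mul_right _ _)

/-- Witt coefficients with prescribed ghost components, where these exist. -/
noncomputable def coeffOfGhost (p : ℕ) (b : ℕ → R) (n : ℕ) : R :=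
  Classical.epsilon fun c => (p : R) ^ n * c =
    b n - ∑ i : Fin n, (p : R) ^ (i : ℕ) * coeffOfGhost p b i ^ p ^ (n - i)

/-- **Dwork's lemma** for rings on which the identity lifts Frobenius. -/
theorem exists_ghostMap_eq (hR : ∀ a : R, (p : R) ∣ a ^ p - a) (b : ℕ → R)
    (hb : ∀ n, (p : R) ^ (n + 1) ∣ b (n + 1) - b n) :
    ∃ y : WittVector p R, ghostMap y = b := by
  have of_dvd (n : ℕ) (h : (p : R) ^ n ∣
      b n - ∑ i ∈ Finset.range n, (p : R) ^ i * coeffOfGhost p b i ^ p ^ (n - i)) :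
      ∑ i ∈ Finset.range (n + 1), (p : R) ^ i * coeffOfGhost p b i ^ p ^ (n - i) = b n := by
    obtain ⟨c, hc⟩ := h
    rw [← Fin.sum_univ_eq_sum_range (fun i => (p : R) ^ i * coeffOfGhost p b i ^ p ^ (n - i))] at hc
    have key : (p : R) ^ n * coeffOfGhost p b n =
        b n - ∑ i : Fin n, (p : R) ^ (i : ℕ) * coeffOfGhost p b i ^ p ^ (n - i) := by
      conv_lhs => rw [coeffOfGhost]
      exact Classical.epsilon_spec (p := fun c => (p : R) ^ n * c =
        b n - ∑ i : Fin n, (p : R) ^ (i : ℕ) * coeffOfGhost p b i ^ p ^ (n - i)) ⟨c, hc.symm⟩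
    rw [Fin.sum_univ_eq_sum_range (fun i => (p : R) ^ i * coeffOfGhost p b i ^ p ^ (n - i))] at key
    rw [Finset.sum_range_succ, Nat.sub_self, pow_zero, pow_one, key, add_sub_cancel]
  refine ⟨mk p (coeffOfGhost p b), funext fun n => ?_⟩
  rw [ghostMap_apply, ghostComponent_eq_sum, coeff_mk]
  induction n with
  | zero => exact of_dvd 0 (by simp)
  | succ n ih =>
    refine of_dvd (n + 1) ?_
    have h := pow_dvd_sum_range_sub_sum_range hR (coeffOfGhost p b) n
    rw [ih] at h
    simpa using dvd_sub (hb n) h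

theorem isUnit_of_isUnit_ghostComponent [IsDomain R] (h : (p : R) ≠ 0)
    (hR : ∀ a : R, (p : R) ∣ a ^ p - a) {x : WittVector p R}
    (hx : ∀ n, IsUnit (ghostComponent n x)) : IsUnit x := by
  choose w hw using hx
  obtain ⟨y, hy⟩ := exists_ghostMap_eq hR (fun n => ((w n)⁻¹ : Rˣ)) fun n => by
    obtain ⟨c, hc⟩ := pow_dvd_ghostComponent_succ_sub hR x n
    rw [← hw, ← hw] at hc
    refine ⟨-(c * ((w n)⁻¹ : Rˣ) * ((w (n + 1))⁻¹ : Rˣ)), ?_⟩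
    linear_combination (-((w n)⁻¹ : Rˣ) * ((w (n + 1))⁻¹ : Rˣ) : R) * hc +
      (((w n)⁻¹ : Rˣ) : R) * (w (n + 1)).mul_inv - (((w (n + 1))⁻¹ : Rˣ) : R) * (w n).mul_inv
  refine IsUnit.of_mul_eq_one y (ghostMap_injective_of_ne_zero h ?_)
  rw [map_mul, map_one, hy]
  ext n
  simp [ghostMap_apply, ← hw]

end WittVector

namespace PadicInt

variable {p : ℕ} [hp : Fact p.Prime]

theorem toZMod_eq_zero_iff_dvd {a : ℤ_[p]} : toZMod a = 0 ↔ (p : ℤ_[p]) ∣ a := by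
  rw [← RingHom.mem_ker, ker_toZMod, maximalIdeal_eq_span_p, Ideal.mem_span_singleton]

theorem dvd_pow_sub_self (a : ℤ_[p]) : (p : ℤ_[p]) ∣ a ^ p - a := by
  rw [← toZMod_eq_zero_iff_dvd, map_sub, map_pow, ZMod.pow_card, sub_self]

theorem isUnit_iff_toZMod_ne_zero {a : ℤ_[p]} : IsUnit a ↔ toZMod a ≠ 0 := by
  rw [← IsLocalRing.notMem_maximalIdeal, ← ker_toZMod, RingHom.mem_ker]

end PadicInt

theorem WittVector.isUnit_of_map_toZMod_eq_one {p : ℕ} [Fact p.Prime] {x : WittVector p ℤ_[p]}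
    (hx : map PadicInt.toZMod x = 1) : IsUnit x := by
  refine isUnit_of_isUnit_ghostComponent PadicInt.prime_p.ne_zero PadicInt.dvd_pow_sub_self
    fun n => PadicInt.isUnit_iff_toZMod_ne_zero.mpr ?_
  have h : PadicInt.toZMod (ghostComponent n x) = ghostComponent n (map PadicInt.toZMod x) := by
    simp [ghostComponent_eq_sum]
  rw [h, hx, map_one]
  exact one_ne_zero


/-- In `W(ℤ_p)`, the element `p − [p]` lies in the image of
the Verschiebung; the element `u₀` with `v(u₀) = p − [p]` is unique; all
coefficients of `u₀ − 1` lie in `pℤ_p`; and `u₀` is a unit. -/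
theorem u0_exists_unique_unit (p : ℕ) [Fact p.Prime] :
    ∃ u₀ : WittVector p ℤ_[p],
      WittVector.verschiebung u₀ =
        (p : WittVector p ℤ_[p]) - WittVector.teichmuller p (p : ℤ_[p]) ∧
      (∀ u : WittVector p ℤ_[p],
        WittVector.verschiebung u =
          (p : WittVector p ℤ_[p]) - WittVector.teichmuller p (p : ℤ_[p]) → u = u₀) ∧
      (∀ n : ℕ, (u₀ - 1).coeff n ∈ Ideal.span {(p : ℤ_[p])}) ∧
      IsUnit u₀ := by
  set d : WittVector p ℤ_[p] := p - WittVector.teichmuller p (p : ℤ_[p]) with hd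
  have hd₀ : d.coeff 0 = 0 := by
    change WittVector.constantCoeff d = 0
    rw [hd, map_sub, map_natCast, sub_eq_zero]
    exact (WittVector.teichmuller_coeff_zero p _).symm
  have hu : WittVector.verschiebung (d.shift 1) = d :=
    (WittVector.verschiebung_shift d 0 fun i hi => by rwa [Nat.lt_one_iff.mp hi]).trans <| by
      ext n
      rw [WittVector.shift_coeff, zero_add]
  have hmap : WittVector.map PadicInt.toZMod (d.shift 1) = 1 := by
    apply WittVector.verschiebung_injective p (ZMod p)
    rw [← WittVector.map_verschiebung, hu, WittVector.verschiebung_zmod, hd]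
    simp
  refine ⟨d.shift 1, hu, fun u h => WittVector.verschiebung_injective p _ (h.trans hu.symm),
    fun n => ?_, WittVector.isUnit_of_map_toZMod_eq_one hmap⟩
  rw [Ideal.mem_span_singleton, ← PadicInt.toZMod_eq_zero_iff_dvd, ← WittVector.map_coeff,
    map_sub, hmap, map_one, sub_self, WittVector.zero_coeff]
end

section
/- Let R be a perfect ring of characteristic p. Let P be a finitely generated projective W(R)-module, and let F, V : P → P be additive maps satisfying F(a·x) = f(a)·F(x) and V(f(a)·x) = a·V(x) for all a ∈ W(R), x ∈ P, as well as F(V(x)) = p·x and V(F(x)) = p·x for all x ∈ P. Then the image V(P) is a W(R)-submodule of P containing p·P, and the quotient P/V(P) is a finitely generated projective module over the quotient ring W(R)/pW(R). -/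
open TensorProduct in
theorem TensorProduct.one_tmul_eq_zero_iff_mem_smul_top {A L : Type*} [CommRing A]
    [AddCommGroup L] [Module A L] (I : Ideal A) (x : L) :
    (1 : A ⧸ I) ⊗ₜ[A] x = 0 ↔ x ∈ I • (⊤ : Submodule A L) := by
  rw [← (quotTensorEquivQuotSMul L I).map_eq_zero_iff,
    quotTensorEquivQuotSMul_mk_one_tmul, Submodule.Quotient.mk_eq_zero]

/-- Over a local ring, the cokernel of `f` is free as soon as `f` reflects divisibility by the
maximal ideal. -/
theorem Module.free_of_mem_maximalIdeal_smul {A K N M : Type*} [CommRing A] [IsLocalRing A]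
    [AddCommGroup K] [Module A K] [AddCommGroup N] [Module A N] [AddCommGroup M] [Module A M]
    [Module.Finite A K] [Module.Finite A N] [Module.Free A N]
    {f : K →ₗ[A] N} {g : N →ₗ[A] M} (hg : Function.Surjective g) (hfg : Function.Exact f g)
    (h : ∀ x, f x ∈ IsLocalRing.maximalIdeal A • (⊤ : Submodule A N) →
      x ∈ IsLocalRing.maximalIdeal A • (⊤ : Submodule A K)) :
    Module.Free A M := by
  refine Module.free_of_lTensor_residueField_injective f g hg hfg ?_
  rw [injective_iff_map_eq_zero]
  intro y hy
  obtain ⟨x, rfl⟩ := TensorProduct.mk_surjective A K (IsLocalRing.ResidueField A)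
    Ideal.Quotient.mk_surjective y
  exact (TensorProduct.one_tmul_eq_zero_iff_mem_smul_top _ x).2
    (h x ((TensorProduct.one_tmul_eq_zero_iff_mem_smul_top _ (f x)).1 hy))

theorem IsLocalRing.maximalIdeal_smul_top_localizedModule {A L : Type*} [CommRing A]
    [AddCommGroup L] [Module A L] (m : Ideal A) [m.IsPrime] :
    IsLocalRing.maximalIdeal (Localization.AtPrime m) •
        (⊤ : Submodule (Localization.AtPrime m) (LocalizedModule m.primeCompl L)) =
      (m • (⊤ : Submodule A L)).localized' (Localization.AtPrime m) m.primeCompl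
        (LocalizedModule.mkLinearMap m.primeCompl L) := by
  have hmap : m.localized' (Localization.AtPrime m) m.primeCompl (Algebra.linearMap A _) =
      IsLocalRing.maximalIdeal (Localization.AtPrime m) := by
    rw [← Localization.AtPrime.map_eq_maximalIdeal, Submodule.localized'_eq_span]
    rfl
  rw [Submodule.localized'_smul, hmap, Submodule.localized'_top]

/-- The cokernel of a map `f` from a finite module to a finite projective module is projective if
`f` reflects divisibility by every maximal ideal. -/
theorem Module.projective_of_mem_maximal_smul {A K N M : Type*} [CommRing A]
    [AddCommGroup K] [Module A K] [AddCommGroup N] [Module A N] [AddCommGroup M] [Module A M]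
    [Module.Finite A K] [Module.Finite A N] [Module.Projective A N]
    {f : K →ₗ[A] N} {g : N →ₗ[A] M} (hg : Function.Surjective g) (hfg : Function.Exact f g)
    (h : ∀ m : Ideal A, m.IsMaximal → ∀ x, f x ∈ m • (⊤ : Submodule A N) →
      x ∈ m • (⊤ : Submodule A K)) :
    Module.Projective A M := by
  have : Module.FinitePresentation A N := Module.finitePresentation_of_projective A N
  have : Module.FinitePresentation A M := Module.finitePresentation_of_surjective g hg (by
    rw [hfg.linearMap_ker_eq, LinearMap.range_eq_map]; exact Module.Finite.fg_top.map f)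
  refine Module.projective_of_localization_maximal fun m hm ↦ ?_
  have : Module.Free (Localization.AtPrime m) (LocalizedModule m.primeCompl N) :=
    Module.free_of_flat_of_isLocalRing
  have : Module.Free (Localization.AtPrime m) (LocalizedModule m.primeCompl M) := by
    refine Module.free_of_mem_maximalIdeal_smul (f := LocalizedModule.map m.primeCompl f)
      (g := LocalizedModule.map m.primeCompl g) (LocalizedModule.map_surjective m.primeCompl g hg)
      (LocalizedModule.map_exact m.primeCompl f g hfg) fun x hx ↦ ?_
    rw [IsLocalRing.maximalIdeal_smul_top_localizedModule] at hx ⊢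
    induction x using LocalizedModule.induction_on with | _ k s
    rw [LocalizedModule.map_mk, Submodule.mem_localized'] at hx
    obtain ⟨n, hn, t, hnt⟩ := hx
    rw [← IsLocalizedModule.mk_eq_mk', LocalizedModule.mk_eq] at hnt
    obtain ⟨u, hu⟩ := hnt
    rw [Submodule.mem_localized']
    refine ⟨(u * t) • k, h m hm _ ?_, u * t * s, ?_⟩
    · have : f ((u * t) • k) = u • s • n := by
        rw [hu, ← mul_smul, Submonoid.smul_def, Submonoid.smul_def, map_smul]
      rw [this]
      exact Submodule.smul_mem _ _ (Submodule.smul_mem _ _ hn)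
    · rw [← IsLocalizedModule.mk_eq_mk', LocalizedModule.mk_cancel_common_left]
  exact .of_free

open TensorProduct in
/-- Let `P` be a finite projective `W`-module and `M` a quotient of `P` which is a `W ⧸ I`-module.
Then `M` is projective over `W ⧸ I` if modulo `I` the kernel `K` of `P → M` satisfies
`K ∩ 𝔪P ⊆ 𝔪K` for all maximal ideals `𝔪`. -/
theorem Module.projective_quotient_of_mem_maximal_smul {W P M : Type*} [CommRing W] {I : Ideal W}
    [AddCommGroup P] [Module W P] [Module.Finite W P] [Module.Projective W P]
    [AddCommGroup M] [Module W M] [Module (W ⧸ I) M] [IsScalarTower W (W ⧸ I) M]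
    {π : P →ₗ[W] M} (hπ : Function.Surjective π) (hfg : (LinearMap.ker π).FG)
    (h : ∀ m : Ideal (W ⧸ I), m.IsMaximal → ∀ x ∈ LinearMap.ker π,
      x ∈ m.comap (Ideal.Quotient.mk I) • (⊤ : Submodule W P) →
      ∃ y ∈ m.comap (Ideal.Quotient.mk I) • LinearMap.ker π, x - y ∈ I • (⊤ : Submodule W P)) :
    Module.Projective (W ⧸ I) M := by
  have : Module.Finite W (LinearMap.ker π) := Module.Finite.iff_fg.2 hfg
  let g : (W ⧸ I) ⊗[W] P →ₗ[W ⧸ I] M := LinearMap.liftBaseChange (W ⧸ I) π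
  have hg (x : P) : g (1 ⊗ₜ x) = π x := by simp [g]
  let N := LinearMap.range ((LinearMap.ker π).subtype.baseChange (W ⧸ I))
  have hN {x : P} (hx : x ∈ LinearMap.ker π) : (1 : W ⧸ I) ⊗ₜ[W] x ∈ N :=
    ⟨1 ⊗ₜ ⟨x, hx⟩, by simp⟩
  have hone (z : (W ⧸ I) ⊗[W] P) : ∃ x : P, 1 ⊗ₜ x = z :=
    TensorProduct.mk_surjective W P (W ⧸ I) Ideal.Quotient.mk_surjective z
  have hsmul (w : W) (x : P) :
      (1 : W ⧸ I) ⊗ₜ[W] (w • x) = Ideal.Quotient.mk I w • (1 : W ⧸ I) ⊗ₜ[W] x := by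
    rw [TensorProduct.tmul_smul]
    exact algebra_compatible_smul (W ⧸ I) w _
  have hgN : LinearMap.ker g = N := by
    ext z
    obtain ⟨x, rfl⟩ := hone z
    rw [LinearMap.mem_ker, hg]
    refine ⟨fun hx ↦ hN hx, fun ⟨y, hy⟩ ↦ ?_⟩
    obtain ⟨y, rfl⟩ := TensorProduct.mk_surjective W (LinearMap.ker π) (W ⧸ I)
      Ideal.Quotient.mk_surjective y
    rw [← hg, ← hy]
    simpa using (hg y).trans y.2
  refine Module.projective_of_mem_maximal_smul (K := N) (f := N.subtype) (g := g)
    (fun y ↦ ?_) ?_ ?_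
  · obtain ⟨x, rfl⟩ := hπ y
    exact ⟨1 ⊗ₜ x, hg x⟩
  · rw [LinearMap.exact_iff, hgN, Submodule.range_subtype]
  · rintro m hm ⟨z, hz⟩ hzm
    rw [Submodule.mem_smul_top_iff]
    obtain ⟨x, rfl⟩ := hone z
    have hlift : ∀ z ∈ m • (⊤ : Submodule (W ⧸ I) ((W ⧸ I) ⊗[W] P)),
        ∃ y ∈ m.comap (Ideal.Quotient.mk I) • (⊤ : Submodule W P), 1 ⊗ₜ y = z := by
      refine fun z hz ↦ Submodule.smul_induction_on hz (fun a ha y _ ↦ ?_) ?_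
      · obtain ⟨w, rfl⟩ := Ideal.Quotient.mk_surjective a
        obtain ⟨y, rfl⟩ := hone y
        exact ⟨w • y, Submodule.smul_mem_smul ha trivial, hsmul w y⟩
      · rintro _ _ ⟨y, hy, rfl⟩ ⟨y', hy', rfl⟩
        exact ⟨y + y', add_mem hy hy', TensorProduct.tmul_add _ _ _⟩
    obtain ⟨x', hx', hxx'⟩ := hlift _ hzm
    have hIm : I ≤ m.comap (Ideal.Quotient.mk I) := fun a ha ↦ by
      rw [Ideal.mem_comap, Ideal.Quotient.eq_zero_iff_mem.2 ha]
      exact zero_mem m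
    have hxm : x ∈ m.comap (Ideal.Quotient.mk I) • (⊤ : Submodule W P) := by
      rw [← sub_add_cancel x x']
      refine add_mem (Submodule.smul_mono_left hIm ?_) hx'
      rw [← TensorProduct.one_tmul_eq_zero_iff_mem_smul_top, TensorProduct.tmul_sub, hxx']
      exact sub_self _
    have hxπ : x ∈ LinearMap.ker π := by
      rwa [← hgN, LinearMap.mem_ker, hg] at hz
    obtain ⟨y, hy, hxy⟩ := h m hm x hxπ hxm
    rw [← TensorProduct.one_tmul_eq_zero_iff_mem_smul_top, TensorProduct.tmul_sub,
      sub_eq_zero] at hxy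
    change (1 : W ⧸ I) ⊗ₜ[W] x ∈ _
    rw [hxy]
    refine Submodule.smul_induction_on hy (fun w hw y hy ↦ ?_) fun y y' hy hy' ↦ ?_
    · rw [hsmul]
      exact Submodule.smul_mem_smul hw (hN hy)
    · rw [TensorProduct.tmul_add]
      exact add_mem hy hy'

namespace WittVector

variable {p : ℕ} [Fact p.Prime] {R : Type*} [CommRing R]

theorem mem_ker_map_quotientMk {n : Ideal R} {w : WittVector p R} :
    w ∈ RingHom.ker (map (p := p) (Ideal.Quotient.mk n)) ↔ ∀ i, w.coeff i ∈ n := by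
  rw [RingHom.mem_ker, WittVector.ext_iff]
  simp [map_coeff, Ideal.Quotient.eq_zero_iff_mem]

theorem comap_constantCoeff_le [CharP R p] [PerfectRing R p] (n : Ideal R) :
    n.comap constantCoeff ≤
      RingHom.ker (map (p := p) (Ideal.Quotient.mk n)) ⊔ Ideal.span {(p : WittVector p R)} := by
  intro w hw
  rw [← ker_constantCoeff, ← add_sub_cancel (teichmuller p (constantCoeff w)) w]
  refine Submodule.add_mem_sup ?_ ?_
  · have hw' : Ideal.Quotient.mk n (constantCoeff w) = 0 := Ideal.Quotient.eq_zero_iff_mem.2 hw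
    rw [RingHom.mem_ker, map_teichmuller, hw', teichmuller_zero]
  · rw [RingHom.mem_ker, map_sub, sub_eq_zero]
    rfl

variable {P : Type*} [AddCommGroup P] [Module (WittVector p R) P]

theorem mem_ker_map_smul_top_of_p_smul_mem [CharP R p] [Module.Projective (WittVector p R) P]
    {n : Ideal R} [n.IsPrime] {x : P}
    (hx : (p : WittVector p R) • x ∈
      RingHom.ker (map (p := p) (Ideal.Quotient.mk n)) • (⊤ : Submodule (WittVector p R) P)) :
    x ∈ RingHom.ker (map (p := p) (Ideal.Quotient.mk n)) •
      (⊤ : Submodule (WittVector p R) P) := by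
  obtain ⟨s, hs⟩ := Module.Projective.out (R := WittVector p R) (P := P)
  have key (i : P) : s x i ∈ RingHom.ker (map (p := p) (Ideal.Quotient.mk n)) := by
    have h : s ((p : WittVector p R) • x) i ∈ RingHom.ker (map (p := p) (Ideal.Quotient.mk n)) := by
      refine Submodule.smul_induction_on hx (fun r hr y _ ↦ ?_) fun y z hy hz ↦ ?_
      · rw [map_smul, Finsupp.smul_apply]
        exact Ideal.mul_mem_right _ _ hr
      · rw [map_add, Finsupp.add_apply]
        exact add_mem hy hz
    rw [map_smul, Finsupp.smul_apply, smul_eq_mul, mul_comm, mem_ker_map_quotientMk] at h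
    refine mem_ker_map_quotientMk.2 fun j ↦ ?_
    have hj := h (j + 1)
    rw [mul_charP_coeff_succ] at hj
    exact Ideal.IsPrime.mem_of_pow_mem ‹_› _ hj
  rw [← hs x, Finsupp.linearCombination_apply]
  exact sum_mem fun i _ ↦ Submodule.smul_mem_smul (key i) trivial

theorem exists_sub_mem_comap_constantCoeff_smul_top [CharP R p] [PerfectRing R p]
    [Module.Projective (WittVector p R) P] {F V : P →+ P}
    (hF : ∀ (a : WittVector p R) (x : P), F (a • x) = frobenius a • F x)
    (hFV : ∀ x : P, F (V x) = (p : WittVector p R) • x)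
    (hVF : ∀ x : P, V (F x) = (p : WittVector p R) • x)
    {n : Ideal R} [n.IsPrime] {x : P}
    (hx : V x ∈ n.comap (constantCoeff (p := p)) • (⊤ : Submodule (WittVector p R) P)) :
    ∃ y, x - F y ∈ n.comap (constantCoeff (p := p)) • (⊤ : Submodule (WittVector p R) P) := by
  have hx' := Submodule.smul_mono_left (comap_constantCoeff_le n) hx
  rw [Submodule.sup_smul, Submodule.mem_sup] at hx'
  obtain ⟨z, hz, q, hq, hzq⟩ := hx'
  rw [Submodule.ideal_span_singleton_smul] at hq
  obtain ⟨y, -, rfl⟩ := hq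
  have hle : RingHom.ker (map (p := p) (Ideal.Quotient.mk n)) ≤ n.comap constantCoeff :=
    fun w hw ↦ mem_ker_map_quotientMk.1 hw 0
  refine ⟨y, Submodule.smul_mono_left hle (mem_ker_map_smul_top_of_p_smul_mem ?_)⟩
  have hz' : V (x - F y) = z := by
    rw [map_sub, hVF, ← hzq]
    exact add_sub_cancel_right z _
  rw [← hFV, hz']
  refine Submodule.smul_induction_on hz (fun a ha y _ ↦ ?_) fun y y' hy hy' ↦ ?_
  · rw [hF]
    refine Submodule.smul_mem_smul (mem_ker_map_quotientMk.2 fun i ↦ ?_) trivial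
    rw [coeff_frobenius_charP]
    exact Ideal.pow_mem_of_mem _ (mem_ker_map_quotientMk.1 ha i) _ (Fact.out : p.Prime).pos
  · rw [map_add]
    exact add_mem hy hy'

end WittVector

/-- Over a perfect ring `R` of characteristic `p`, given a
finitely generated projective `W(R)`-module `P` with operators `F, V` as in a
Dieudonné module, the image `V(P)` is a submodule containing `p·P`, and the
quotient `P/V(P)` is a finitely generated projective module over
`W(R)/pW(R)`. -/
theorem dieudonne_module_coker_V_projective
    (p : ℕ) [Fact p.Prime] (R : Type u) [CommRing R] [CharP R p]
    (hR : Function.Bijective fun x : R => x ^ p)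
    (P : Type v) [AddCommGroup P] [Module (WittVector p R) P]
    [Module.Finite (WittVector p R) P] [Module.Projective (WittVector p R) P]
    (F V : P →+ P)
    (hF : ∀ (a : WittVector p R) (x : P), F (a • x) = WittVector.frobenius a • F x)
    (hV : ∀ (a : WittVector p R) (x : P), V (WittVector.frobenius a • x) = a • V x)
    (hFV : ∀ x : P, F (V x) = (p : WittVector p R) • x)
    (hVF : ∀ x : P, V (F x) = (p : WittVector p R) • x) :
    ∃ Q : Submodule (WittVector p R) P,
      (Q : Set P) = Set.range V ∧
      (∀ x : P, (p : WittVector p R) • x ∈ Q) ∧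
      ∃ (M : Type v) (_ : AddCommGroup M)
        (_ : Module (WittVector p R ⧸ Ideal.span {(p : WittVector p R)}) M),
        Module.Finite (WittVector p R ⧸ Ideal.span {(p : WittVector p R)}) M ∧
        Module.Projective (WittVector p R ⧸ Ideal.span {(p : WittVector p R)}) M ∧
        ∃ e : (P ⧸ Q) ≃+ M,
          ∀ (a : WittVector p R) (x : P ⧸ Q),
            e (a • x) = Ideal.Quotient.mk (Ideal.span {(p : WittVector p R)}) a • e x := by
  have : PerfectRing R p := ⟨hR⟩
  let W := WittVector p R
  let A := W ⧸ Ideal.span {(p : W)}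
  let σ : W ≃+* W := (WittVector.frobeniusEquiv p R).symm
  have hVσ (a : W) (x : P) : V (a • x) = σ a • V x := by
    rw [← hV, ← WittVector.frobeniusEquiv_apply, RingEquiv.apply_symm_apply]
  let V' : P →ₛₗ[(σ : W →+* W)] P := { V with map_smul' := hVσ }
  let Q : Submodule W P := LinearMap.range V'
  have hpQ (x : P) : (p : W) • x ∈ Q := ⟨F x, hVF x⟩
  have : Module.Finite W Q := by
    rw [Module.Finite.iff_fg]
    change (LinearMap.range V').FG
    rw [LinearMap.range_eq_map]
    exact Module.Finite.fg_top.map V'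
  have htors : Module.IsTorsionBySet W (P ⧸ Q) (Ideal.span {(p : W)}) := by
    rw [Module.isTorsionBySet_span_singleton_iff]
    intro x
    obtain ⟨x, rfl⟩ := Submodule.Quotient.mk_surjective _ x
    exact (Submodule.Quotient.mk_eq_zero _).2 (hpQ x)
  let _ : Module A (P ⧸ Q) := htors.module
  have : IsScalarTower W A (P ⧸ Q) := htors.isScalarTower
  refine ⟨Q, rfl, hpQ, P ⧸ Q, inferInstance, inferInstance,
    Module.Finite.of_restrictScalars_finite W A (P ⧸ Q), ?_, AddEquiv.refl _, fun a x ↦ rfl⟩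
  refine Module.projective_quotient_of_mem_maximal_smul Q.mkQ_surjective ?_ fun m hm z hz hzm ↦ ?_
  · rwa [Submodule.ker_mkQ, ← Module.Finite.iff_fg]
  · rw [Submodule.ker_mkQ] at hz ⊢
    obtain ⟨x, rfl⟩ := hz
    let e := (WittVector.quotientPEquiv (p := p) (k := R)).symm
    let n : Ideal R := m.comap e
    have hn : n.IsPrime := Ideal.comap_isPrime e m
    have hmn : m.comap (Ideal.Quotient.mk _) = n.comap (WittVector.constantCoeff (p := p)) := by
      ext w
      have : e (WittVector.constantCoeff w) = Ideal.Quotient.mk _ w := by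
        rw [← WittVector.quotientPEquiv_mk]
        exact RingEquiv.symm_apply_apply _ _
      rw [Ideal.mem_comap, Ideal.mem_comap, Ideal.mem_comap, this]
    rw [hmn] at hzm ⊢
    obtain ⟨y, hy⟩ := WittVector.exists_sub_mem_comap_constantCoeff_smul_top hF hFV hVF hzm
    refine ⟨V (x - F y), ?_, ?_⟩
    · refine Submodule.smul_induction_on hy (fun w hw y _ ↦ ?_) fun y y' hy hy' ↦ ?_
      · rw [hVσ]
        refine Submodule.smul_mem_smul (hn.mem_of_pow_mem p ?_) ⟨y, rfl⟩
        have : WittVector.frobenius (σ w) = w := by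
          rw [← WittVector.frobeniusEquiv_apply, RingEquiv.apply_symm_apply]
        change (σ w).coeff 0 ^ p ∈ n
        rwa [← WittVector.coeff_frobenius_charP, this]
      · rw [map_add]
        exact add_mem hy hy'
    · have : V x - V (x - F y) = (p : W) • y := by rw [map_sub, hVF, sub_sub_cancel]
      change V x - _ ∈ _
      rw [this]
      exact Submodule.smul_mem_smul (Ideal.mem_span_singleton_self _) trivial
end

section
/- Let φ : A → B be an injective ring homomorphism between admissible rings. Then the induced map W(φ) : W(A) → W(B) is injective, and for every x ∈ W(A) one has x ∈ 𝕎(A) if and only if W(φ)(x) ∈ 𝕎(B); in other words 𝕎(A) = W(A) ∩ 𝕎(B) inside W(B). -/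
/-- A commutative ring `R` is *admissible* (for the prime `p`) if its
nilradical `N_R` is bounded nilpotent and `R_red = R/N_R` is a perfect ring of
characteristic `p`. -/
def IsAdmissible (p : ℕ) (R : Type*) [CommRing R] : Prop :=
  (∃ m : ℕ, 1 ≤ m ∧ ∀ x ∈ nilradical R, x ^ m = 0) ∧
  (p : R ⧸ nilradical R) = 0 ∧
  Function.Bijective fun x : R ⧸ nilradical R => x ^ p

/-- `Ŵ(N_R)`: the set of Witt vectors all of whose coefficients are nilpotent
and all but finitely many are zero. -/
def hatW (p : ℕ) (R : Type*) [CommRing R] : Set (WittVector p R) :=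
  {x | (∀ n, IsNilpotent (x.coeff n)) ∧ ∃ N, ∀ n ≥ N, x.coeff n = 0}

/-- The Zink ring `𝕎(R) = {s(y) + z : y ∈ W(R_red), z ∈ Ŵ(N_R)}`, as a subset
of `W(R)`, relative to a section `s : W(R_red) → W(R)`. -/
def zinkSet (p : ℕ) [Fact p.Prime] (R : Type*) [CommRing R]
    (s : WittVector p (R ⧸ nilradical R) →+* WittVector p R) :
    Set (WittVector p R) :=
  {w | ∃ (y : WittVector p (R ⧸ nilradical R)) (z : WittVector p R),
        z ∈ hatW p R ∧ w = s y + z}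

namespace WittVector

variable {p : ℕ} [Fact p.Prime] {R : Type*} [CommRing R]

theorem exists_verschiebung_eq_of_coeff_zero {x : WittVector p R} (h : x.coeff 0 = 0) :
    ∃ y, x = verschiebung y :=
  ⟨x.shift 1, by simpa using eq_iterate_verschiebung (n := 1) (by simp [h])⟩

theorem exists_prime_pow_mul_eq_verschiebung {m : ℕ} (hm : (p : R) ^ m = 0)
    (x : WittVector p R) : ∃ y, (p : WittVector p R) ^ m * x = verschiebung y := by
  refine exists_verschiebung_eq_of_coeff_zero ?_
  change constantCoeff ((p : WittVector p R) ^ m * x) = 0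
  rw [map_mul, map_pow, map_natCast, hm, zero_mul]

theorem exists_prime_pow_mul_eq_iterate_verschiebung {m : ℕ} (hm : (p : R) ^ m = 0) (n : ℕ)
    (x : WittVector p R) :
    ∃ y, (p : WittVector p R) ^ (m * n) * x = verschiebung^[n] y := by
  induction n generalizing x with
  | zero => exact ⟨x, by simp⟩
  | succ n ih =>
    obtain ⟨y, hy⟩ := exists_prime_pow_mul_eq_verschiebung hm x
    obtain ⟨z, hz⟩ := ih y
    refine ⟨z, ?_⟩
    rw [Nat.mul_succ, pow_add, mul_assoc, hy, Function.iterate_succ_apply', ← hz]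
    have := map_nsmul (verschiebung (p := p) (R := R)) (p ^ (m * n)) y
    simpa [nsmul_eq_mul] using this.symm

/-- If `p` is nilpotent in `R`, then `W(R)` is `p`-adically separated. -/
theorem eq_zero_of_forall_prime_pow_dvd (hp : IsNilpotent (p : R)) {x : WittVector p R}
    (h : ∀ n : ℕ, (p : WittVector p R) ^ n ∣ x) : x = 0 := by
  obtain ⟨m, hm⟩ := hp
  ext n
  obtain ⟨y, rfl⟩ := h (m * (n + 1))
  obtain ⟨z, hz⟩ := exists_prime_pow_mul_eq_iterate_verschiebung hm (n + 1) y
  rw [hz, iterate_verschiebung_coeff_eq_zero z (Nat.lt_succ_self n), zero_coeff]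

theorem prime_dvd_verschiebung_mul_verschiebung (x : WittVector p R) :
    (p : WittVector p R) ∣ verschiebung x * verschiebung x := by
  rw [← verschiebung_mul_frobenius, frobenius_verschiebung]
  have := map_nsmul (verschiebung (p := p) (R := R)) p (x * x)
  refine ⟨verschiebung (x * x), ?_⟩
  rw [nsmul_eq_mul, nsmul_eq_mul] at this
  rw [← this]
  congr 1
  ring

theorem prime_dvd_pow_of_coeff_zero_pow_eq_zero {m : ℕ} {x : WittVector p R}
    (h : x.coeff 0 ^ m = 0) : (p : WittVector p R) ∣ x ^ (2 * m) := by
  have h0 : (x ^ m).coeff 0 = 0 := by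
    change constantCoeff (x ^ m) = 0
    rw [map_pow]
    exact h
  obtain ⟨y, hy⟩ := exists_verschiebung_eq_of_coeff_zero h0
  rw [two_mul, pow_add, hy]
  exact prime_dvd_verschiebung_mul_verschiebung y

theorem prime_pow_dvd_pow_sub_pow {m : ℕ} {x y : WittVector p R}
    (h : (x - y).coeff 0 ^ m = 0) (n : ℕ) :
    (p : WittVector p R) ^ n ∣ x ^ p ^ (2 * m + n) - y ^ p ^ (2 * m + n) := by
  have hp : p.Prime := Fact.out
  have h1 : (p : WittVector p R) ∣ x ^ p ^ (2 * m) - y ^ p ^ (2 * m) := by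
    obtain ⟨r, hr⟩ := exists_add_pow_prime_pow_eq hp (x - y) y (2 * m)
    rw [sub_add_cancel] at hr
    have h2 : (p : WittVector p R) ∣ (x - y) ^ p ^ (2 * m) :=
      (prime_dvd_pow_of_coeff_zero_pow_eq_zero h).trans
        (pow_dvd_pow _ (Nat.lt_pow_self hp.one_lt).le)
    rw [hr, add_right_comm, add_sub_cancel_right, mul_assoc, mul_assoc]
    exact dvd_add h2 (dvd_mul_right _ _)
  rw [pow_add p, pow_mul x, pow_mul y]
  exact (pow_dvd_pow _ n.le_succ).trans (dvd_sub_pow_of_dvd_sub h1 n)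

/-- Two ring homomorphisms out of the Witt vectors of a perfect ring agree if they agree
modulo elements of bounded nilpotence in the zeroth coefficient. -/
theorem ringHom_eq_of_sub_coeff_zero_pow_eq_zero {k : Type*} [CommRing k] [CharP k p]
    [PerfectRing k p] (hp : IsNilpotent (p : R)) {m : ℕ}
    (f g : WittVector p k →+* WittVector p R)
    (h : ∀ y, (f y - g y).coeff 0 ^ m = 0) : f = g := by
  have teich (a : k) : f (teichmuller p a) = g (teichmuller p a) := by
    rw [← sub_eq_zero]
    refine eq_zero_of_forall_prime_pow_dvd hp fun n => ?_
    obtain ⟨b, rfl⟩ := (bijective_iterateFrobenius k p (2 * m + n)).surjective a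
    rw [iterateFrobenius_def, map_pow, map_pow, map_pow]
    exact prime_pow_dvd_pow_sub_pow (h _) n
  refine RingHom.ext fun y => sub_eq_zero.mp ?_
  refine eq_zero_of_forall_prime_pow_dvd hp fun n => ?_
  induction n generalizing y with
  | zero => simp
  | succ n ih =>
    have hy : y - teichmuller p (y.coeff 0) ∈ Ideal.span {(p : WittVector p k)} := by
      rw [mem_span_p_iff_coeff_zero_eq_zero]
      change constantCoeff (y - teichmuller p (y.coeff 0)) = 0
      rw [map_sub]
      change y.coeff 0 - (teichmuller p (y.coeff 0)).coeff 0 = 0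
      rw [teichmuller_coeff_zero, sub_self]
    obtain ⟨z, hz⟩ := Ideal.mem_span_singleton.mp hy
    rw [sub_eq_iff_eq_add] at hz
    have key : f y - g y = p * (f z - g z) := by
      rw [hz]
      simp only [map_add, map_mul, map_natCast, teich]
      ring
    rw [key, pow_succ']
    exact mul_dvd_mul_left _ (ih z)

end WittVector

open WittVector in
/-- The sections of `W(R) → W(R_red)` are natural in the admissible ring `R`. -/
theorem IsAdmissible.map_section_apply {p : ℕ} [Fact p.Prime] {A B : Type*} [CommRing A]
    [CommRing B] (hA : IsAdmissible p A) (hB : IsAdmissible p B) (φ : A →+* B)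
    {sA : WittVector p (A ⧸ nilradical A) →+* WittVector p A}
    (hsA : (WittVector.map (Ideal.Quotient.mk (nilradical A))).comp sA = RingHom.id _)
    {sB : WittVector p (B ⧸ nilradical B) →+* WittVector p B}
    (hsB : (WittVector.map (Ideal.Quotient.mk (nilradical B))).comp sB = RingHom.id _)
    {ψ : A ⧸ nilradical A →+* B ⧸ nilradical B}
    (hψ : ψ.comp (Ideal.Quotient.mk _) = (Ideal.Quotient.mk _).comp φ)
    (y : WittVector p (A ⧸ nilradical A)) :
    WittVector.map φ (sA y) = sB (WittVector.map ψ y) := by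
  obtain ⟨-, hpA, hperf⟩ := hA
  obtain ⟨⟨m, -, hm⟩, hpB, -⟩ := hB
  rcases subsingleton_or_nontrivial (A ⧸ nilradical A) with hs | hs
  · have : y = 0 := by ext; exact Subsingleton.elim _ _
    simp [this]
  have := (CharP.charP_iff_prime_eq_zero (R := A ⧸ nilradical A) Fact.out).mpr hpA
  have : PerfectRing (A ⧸ nilradical A) p := ⟨hperf⟩
  have hp : IsNilpotent (p : B) :=
    mem_nilradical.mp (Ideal.Quotient.eq_zero_iff_mem.mp (by simpa using hpB))
  refine RingHom.congr_fun (ringHom_eq_of_sub_coeff_zero_pow_eq_zero hp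
    ((WittVector.map φ).comp sA) (sB.comp (WittVector.map ψ)) (m := m) fun z => hm _ ?_) y
  rw [← Ideal.Quotient.eq_zero_iff_mem, ← WittVector.map_coeff, map_sub]
  have h1 : WittVector.map (Ideal.Quotient.mk (nilradical B)) (WittVector.map φ (sA z)) =
      WittVector.map ψ z := by
    conv_rhs => rw [← RingHom.id_apply z, ← hsA]
    ext n
    simpa using (RingHom.congr_fun hψ _).symm
  have h2 := RingHom.congr_fun hsB (WittVector.map ψ z)
  simp only [RingHom.comp_apply, RingHom.id_apply] at h2 ⊢
  rw [h1, h2, sub_self, zero_coeff]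

theorem isNilpotent_coeff_iff_map_mk_eq_zero {p : ℕ} [Fact p.Prime] {R : Type*} [CommRing R]
    {z : WittVector p R} :
    (∀ n, IsNilpotent (z.coeff n)) ↔
      WittVector.map (Ideal.Quotient.mk (nilradical R)) z = 0 := by
  simp_rw [WittVector.ext_iff, WittVector.map_coeff, WittVector.zero_coeff,
    Ideal.Quotient.eq_zero_iff_mem, mem_nilradical]

theorem mem_hatW_iff_map_mem_hatW {p : ℕ} [Fact p.Prime] {A B : Type*} [CommRing A] [CommRing B]
    {φ : A →+* B} (hφ : Function.Injective φ) {z : WittVector p A} :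
    z ∈ hatW p A ↔ WittVector.map φ z ∈ hatW p B := by
  simp [hatW, WittVector.map_coeff, IsNilpotent.map_iff hφ, map_eq_zero_iff φ hφ]

/-- For an injective homomorphism `φ : A → B` of admissible
rings, `W(φ)` is injective, and `𝕎(A) = W(A) ∩ 𝕎(B)` inside `W(B)`. -/
theorem zinkSet_eq_preimage_of_injective (p : ℕ) [Fact p.Prime]
    (A B : Type*) [CommRing A] [CommRing B]
    (hA : IsAdmissible p A) (hB : IsAdmissible p B)
    (φ : A →+* B) (hφ : Function.Injective φ)
    (sA : WittVector p (A ⧸ nilradical A) →+* WittVector p A)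
    (hsA : (WittVector.map (Ideal.Quotient.mk (nilradical A))).comp sA = RingHom.id _)
    (sB : WittVector p (B ⧸ nilradical B) →+* WittVector p B)
    (hsB : (WittVector.map (Ideal.Quotient.mk (nilradical B))).comp sB = RingHom.id _) :
    Function.Injective (WittVector.map φ : WittVector p A → WittVector p B) ∧
    ∀ x : WittVector p A,
      x ∈ zinkSet p A sA ↔ WittVector.map φ x ∈ zinkSet p B sB := by
  refine ⟨WittVector.map_injective φ hφ, fun x => ?_⟩
  let ψ : A ⧸ nilradical A →+* B ⧸ nilradical B :=
    Ideal.quotientMap (nilradical B) φ fun a ha => (mem_nilradical.mp ha).map φ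
  have hψ : ψ.comp (Ideal.Quotient.mk _) = (Ideal.Quotient.mk _).comp φ :=
    Ideal.quotientMap_comp_mk _
  have hs := hA.map_section_apply hB φ hsA hsB hψ
  constructor
  · rintro ⟨y, z, hz, rfl⟩
    exact ⟨WittVector.map ψ y, WittVector.map φ z, (mem_hatW_iff_map_mem_hatW hφ).mp hz,
      by rw [map_add, hs]⟩
  · rintro ⟨y, z, hz, hx⟩
    set x₀ := WittVector.map (Ideal.Quotient.mk (nilradical A)) x with hx₀
    have hy : WittVector.map ψ x₀ = y := by
      have h1 := congrArg (WittVector.map (Ideal.Quotient.mk (nilradical B))) hx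
      rw [map_add, isNilpotent_coeff_iff_map_mk_eq_zero.mp hz.1, add_zero] at h1
      have h2 := RingHom.congr_fun hsB y
      rw [RingHom.comp_apply, RingHom.id_apply] at h2
      rw [← h2, ← h1]
      ext n
      simpa [hx₀] using RingHom.congr_fun hψ (x.coeff n)
    refine ⟨x₀, x - sA x₀, (mem_hatW_iff_map_mem_hatW hφ).mpr ?_, by ring⟩
    rwa [map_sub, hs, hy, hx, add_sub_cancel_left]
end

section
/- For every admissible ring R, the Zink ring 𝕎(R) is p-adically complete and separated; that is, the canonical ring homomorphism 𝕎(R) → lim_n 𝕎(R)/p^n·𝕎(R) is bijective. -/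
/-- If a ring `B` retracts onto a `q`-adically complete ring `A` and the kernel of the retraction
is killed by a power of `q`, then `B` is `q`-adically complete. -/
theorem IsAdicComplete.of_retract {A B : Type*} [CommRing A] [CommRing B] (q : ℕ)
    [IsAdicComplete (Ideal.span {(q : A)}) A] (i : A →+* B) (r : B →+* A)
    (hri : ∀ a, r (i a) = a) (M : ℕ) (hM : ∀ x, r x = 0 → (q : B) ^ M * x = 0) :
    IsAdicComplete (Ideal.span {(q : B)}) B where
  haus' x hx := by
    simp only [smul_eq_mul, Ideal.mul_top, Ideal.span_singleton_pow, SModEq.zero,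
      Ideal.mem_span_singleton] at hx
    have hrx : r x = 0 := by
      refine IsHausdorff.haus (I := Ideal.span {(q : A)}) inferInstance _ fun n => ?_
      simp only [smul_eq_mul, Ideal.mul_top, Ideal.span_singleton_pow, SModEq.zero,
        Ideal.mem_span_singleton]
      simpa using map_dvd r (hx n)
    obtain ⟨y, hy⟩ := hx M
    have h := hM (y - i (r y)) (by simp [hri])
    have hry : (q : A) ^ M * r y = 0 := by simpa [hy] using hrx
    have hiry : (q : B) ^ M * i (r y) = 0 := by simpa using congrArg i hry
    rw [hy]
    linear_combination h + hiry
  prec' f hf := by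
    simp only [smul_eq_mul, Ideal.mul_top, Ideal.span_singleton_pow, SModEq.sub_mem,
      Ideal.mem_span_singleton] at hf ⊢
    obtain ⟨L, hL⟩ := IsPrecomplete.prec (I := Ideal.span {(q : A)}) (M := A) inferInstance
      (f := fun n => r (f n)) (by
        intro m n hmn
        simp only [smul_eq_mul, Ideal.mul_top, Ideal.span_singleton_pow, SModEq.sub_mem,
          Ideal.mem_span_singleton]
        simpa using map_dvd r (hf hmn))
    simp only [smul_eq_mul, Ideal.mul_top, Ideal.span_singleton_pow, SModEq.sub_mem,
      Ideal.mem_span_singleton] at hL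
    have key : ∀ n, M ≤ n → (q : B) ^ n ∣ f n - (f M + i (L - r (f M))) := by
      intro n hn
      obtain ⟨w, hw⟩ := hf hn
      have h := hM (w - i (r w)) (by simp [hri])
      have hrw : i (r (f M)) - i (r (f n)) = (q : B) ^ M * i (r w) := by
        simpa using congrArg (fun z => i (r z)) hw
      have hd : (q : B) ^ n ∣ i (r (f n)) - i L := by simpa using map_dvd i (hL n)
      have he : f n - (f M + i (L - r (f M))) = i (r (f n)) - i L := by
        rw [map_sub]
        linear_combination -hw + hrw - h
      rwa [he]
    refine ⟨f M + i (L - r (f M)), fun n => ?_⟩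
    rcases le_total M n with hn | hn
    · exact key n hn
    · have h := dvd_add (hf hn) ((pow_dvd_pow (q : B) hn).trans (key M le_rfl))
      rwa [sub_add_sub_cancel] at h

namespace WittVector

variable {p : ℕ} [hp : Fact p.Prime]

/-- In a domain of characteristic zero, a Witt vector whose `n`-th ghost component is divisible by
`p ^ (n + c)` for all `n` has all its coefficients divisible by `p ^ c`. -/
theorem pow_dvd_coeff_of_pow_dvd_ghostComponent {A : Type*} [CommRing A] [IsDomain A] [CharZero A]
    {u : WittVector p A} {c : ℕ} (hc : 1 ≤ c)
    (hu : ∀ n, (p : A) ^ (n + c) ∣ ghostComponent n u) (n : ℕ) : (p : A) ^ c ∣ u.coeff n := by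
  induction n using Nat.strong_induction_on with
  | _ n ih =>
    have h := hu n
    rw [ghostComponent_apply, aeval_wittPolynomial, Finset.sum_range_succ] at h
    have hsum : (p : A) ^ (n + c) ∣
        ∑ j ∈ Finset.range n, (p : A) ^ j * u.coeff j ^ p ^ (n - j) := by
      refine Finset.dvd_sum fun j hj => ?_
      have hjn := Finset.mem_range.mp hj
      have hd := mul_dvd_mul_left ((p : A) ^ j) (pow_dvd_pow_of_dvd (ih j hjn) (p ^ (n - j)))
      rw [← pow_mul, ← pow_add] at hd
      refine (pow_dvd_pow _ ?_).trans hd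
      have hlt : n - j < p ^ (n - j) := Nat.lt_pow_self hp.out.one_lt
      have hle : c - 1 + (n - j + 1) ≤ c * (n - j + 1) := by
        obtain ⟨d, rfl⟩ : ∃ d, c = d + 1 := ⟨c - 1, by omega⟩
        simp only [Nat.add_sub_cancel]
        nlinarith [Nat.zero_le (d * (n - j))]
      have := Nat.mul_le_mul_left c hlt
      simp only [Nat.succ_eq_add_one] at this
      omega
    have h' := (dvd_add_right hsum).mp h
    rw [Nat.sub_self, pow_zero, pow_one, pow_add] at h'
    exact (mul_dvd_mul_iff_left (pow_ne_zero n (Nat.cast_ne_zero.mpr hp.out.ne_zero))).mp h'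

/-- If all the coefficients of a Witt vector are divisible by `p`, then all the coefficients of its
product with `p ^ k` are divisible by `p ^ (k + 1)`. -/
theorem pow_succ_dvd_coeff_pow_mul {R : Type*} [CommRing R] {w : WittVector p R}
    (hw : ∀ n, (p : R) ∣ w.coeff n) (k n : ℕ) :
    (p : R) ^ (k + 1) ∣ ((p : WittVector p R) ^ k * w).coeff n := by
  choose a ha using hw
  let u : WittVector p (MvPolynomial ℕ ℤ) := mk p fun j => (p : MvPolynomial ℕ ℤ) * MvPolynomial.X j
  let φ : MvPolynomial ℕ ℤ →+* R := MvPolynomial.eval₂Hom (Int.castRingHom R) a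
  have huw : map φ u = w := by
    ext j
    simp [u, φ, map_coeff, ha]
  have hu : (p : MvPolynomial ℕ ℤ) ^ (k + 1) ∣
      ((p : WittVector p (MvPolynomial ℕ ℤ)) ^ k * u).coeff n := by
    refine pow_dvd_coeff_of_pow_dvd_ghostComponent (Nat.le_add_left 1 k) (fun m => ?_) n
    rw [map_mul, map_pow, map_natCast, show m + (k + 1) = k + (m + 1) by omega, pow_add]
    refine mul_dvd_mul_left _ ?_
    rw [ghostComponent_apply, aeval_wittPolynomial]
    refine Finset.dvd_sum fun j hj => ?_
    have hjm : j ≤ m := Nat.lt_succ_iff.mp (Finset.mem_range.mp hj)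
    simp only [u, coeff_mk]
    rw [mul_pow, ← mul_assoc, ← pow_add]
    refine Dvd.dvd.mul_right (pow_dvd_pow _ ?_) _
    have : m - j < p ^ (m - j) := Nat.lt_pow_self hp.out.one_lt
    omega
  have h := map_dvd φ hu
  rw [← map_coeff, map_mul, huw] at h
  simpa using h

/-- If `p` is nilpotent in `R`, then Witt vectors whose coefficients `x` all satisfy `x ^ m = 0`
are killed by a uniform power of `p`. -/
theorem exists_pow_mul_eq_zero {R : Type*} [CommRing R] (hpR : IsNilpotent (p : R)) (m : ℕ) :
    ∃ M : ℕ, ∀ w : WittVector p R, (∀ n, w.coeff n ^ m = 0) → (p : WittVector p R) ^ M * w = 0 := by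
  obtain ⟨k, hk⟩ := hpR
  refine ⟨k + m, fun w hw => ?_⟩
  have hdvd : ∀ n, (p : R) ∣ ((p : WittVector p R) ^ m * w).coeff n := by
    intro n
    rw [← Ideal.mem_span_singleton, ← Ideal.Quotient.eq_zero_iff_mem, ← map_coeff, map_mul,
      map_pow, map_natCast]
    rcases subsingleton_or_nontrivial (R ⧸ Ideal.span {(p : R)}) with _ | _
    · exact Subsingleton.elim _ _
    have hp0 : (p : R ⧸ Ideal.span {(p : R)}) = 0 := by
      rw [← map_natCast (Ideal.Quotient.mk _), Ideal.Quotient.eq_zero_iff_mem]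
      exact Ideal.mem_span_singleton_self _
    have : CharP (R ⧸ Ideal.span {(p : R)}) p := (CharP.charP_iff_prime_eq_zero hp.out).mpr hp0
    rw [mul_comm]
    rcases lt_or_ge n m with hn | hn
    · exact mul_pow_charP_coeff_zero _ hn
    · obtain ⟨j, rfl⟩ := Nat.exists_eq_add_of_le' hn
      rw [mul_pow_charP_coeff_succ, map_coeff, ← map_pow]
      have hle : m ≤ p ^ m := (Nat.lt_pow_self hp.out.one_lt).le
      rw [pow_eq_zero_of_le hle (hw j), map_zero]
  ext n
  have h := pow_succ_dvd_coeff_pow_mul hdvd k n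
  rw [pow_succ, hk, zero_mul, zero_dvd_iff, ← mul_assoc, ← pow_add] at h
  rw [h, zero_coeff]

end WittVector


/-- For every admissible ring `R`, the Zink ring `𝕎(R)` is
`p`-adically complete and separated. -/
theorem zink_ring_p_adically_complete (p : ℕ) [Fact p.Prime]
    (R : Type*) [CommRing R] (hR : IsAdmissible p R)
    (s : WittVector p (R ⧸ nilradical R) →+* WittVector p R)
    (hs : (WittVector.map (Ideal.Quotient.mk (nilradical R))).comp s = RingHom.id _)
    (S : Subring (WittVector p R)) (hS : (S : Set (WittVector p R)) = zinkSet p R s) :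
    IsAdicComplete (Ideal.span {(p : S)}) S := by
  obtain ⟨⟨m, -, hm⟩, hp0, hperf⟩ := hR
  have hpN : IsNilpotent (p : R) := by
    rw [← mem_nilradical, ← Ideal.Quotient.eq_zero_iff_mem, map_natCast, hp0]
  obtain ⟨M, hM⟩ := WittVector.exists_pow_mul_eq_zero hpN m
  have : IsAdicComplete (Ideal.span {(p : WittVector p (R ⧸ nilradical R))})
      (WittVector p (R ⧸ nilradical R)) := by
    rcases subsingleton_or_nontrivial (R ⧸ nilradical R) with _ | _
    · have : Subsingleton (WittVector p (R ⧸ nilradical R)) :=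
        ⟨fun x y => WittVector.ext fun n => Subsingleton.elim _ _⟩
      infer_instance
    · have : CharP (R ⧸ nilradical R) p := (CharP.charP_iff_prime_eq_zero Fact.out).mpr hp0
      have : PerfectRing (R ⧸ nilradical R) p := ⟨hperf⟩
      infer_instance
  have hsS : ∀ y, s y ∈ S := by
    intro y
    rw [← SetLike.mem_coe, hS]
    exact ⟨y, 0, by simp [hatW], by simp⟩
  refine IsAdicComplete.of_retract p (s.codRestrict S hsS)
    ((WittVector.map (Ideal.Quotient.mk (nilradical R))).comp S.subtype)
    (fun y => RingHom.congr_fun hs y) M fun x hx => ?_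
  refine Subtype.ext ?_
  simp only [Subring.coe_mul, SubmonoidClass.coe_pow, Subring.coe_natCast, Subring.coe_zero]
  refine hM _ fun n => hm _ ?_
  rw [← Ideal.Quotient.eq_zero_iff_mem, ← WittVector.map_coeff]
  exact (congrArg (fun w => WittVector.coeff w n) hx).trans (WittVector.zero_coeff p _ n)
end
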